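/- arXiv:2209.02195 — 2 statements merged into one kernel-verified Lean document; each statement's English description precedes it below -/
import Mathlib

section
/- Let M_1 = (S, 𝓘_1, ≻_1) and M_2 = (S, 𝓘_2, ≻_2) be ordered matroids on the same finite ground set S, each given as a direct sum of matroids on disjoint parts of S. Then there exists a popular common independent set, i.e., there is I ∈ 𝓘_1 ∩ 𝓘_2 such that vote_1(I,J) + vote_2(I,J) ≥ 0 for every J ∈ 𝓘_1 ∩ 𝓘_2. -/
open Finset
open scoped Classical

noncomputable section

/-- A matroid on the finite ground set `α`, given by its independence predicate on finsets. -/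
structure FinMatroid (α : Type*) [DecidableEq α] where
  Indep : Finset α → Prop
  exists_indep : ∃ I, Indep I
  indep_subset : ∀ ⦃I J : Finset α⦄, I ⊆ J → Indep J → Indep I
  indep_exchange : ∀ ⦃I J : Finset α⦄, Indep I → Indep J → I.card < J.card →
    ∃ v ∈ J \ I, Indep (insert v I)

/-- `N` is a pairing between `I \ J` and `J \ I`: a set of pairwise disjoint pairs `(u, v)`
with `u ∈ I \ J` and `v ∈ J \ I`. -/
def IsPairing {α : Type*} [DecidableEq α] (I J : Finset α) (N : Finset (α × α)) : Prop :=
  (∀ p ∈ N, p.1 ∈ I \ J ∧ p.2 ∈ J \ I) ∧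
  (∀ p ∈ N, ∀ q ∈ N, p.1 = q.1 → p = q) ∧
  (∀ p ∈ N, ∀ q ∈ N, p.2 = q.2 → p = q)

/-- `N` is a weakly feasible pairing for `(I, J)`:
(1) `I - u + v` is independent for every `(u, v) ∈ N`, and
(2) every `v ∈ J \ I` with `I + v` dependent is covered by `N`. -/
def WeaklyFeasible {α : Type*} [DecidableEq α] (M : FinMatroid α) (I J : Finset α)
    (N : Finset (α × α)) : Prop :=
  IsPairing I J N ∧
  (∀ p ∈ N, M.Indep (insert p.2 (I.erase p.1))) ∧
  (∀ v ∈ J \ I, ¬ M.Indep (insert v I) → ∃ p ∈ N, p.2 = v)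

/-- `N` is a feasible pairing for `(I, J)` with respect to the direct-sum partition
`part : α → ι`: in addition to weak feasibility,
(3) every `u ∈ I \ J` with `J + u` dependent is covered by `N`,
(4) both entries of each pair lie in the same part, and
(5) for every part `j`, the number of pairs inside part `j` is
`min (|S_j ∩ (I \ J)|, |S_j ∩ (J \ I)|)`. -/
def Feasible {α ι : Type*} [DecidableEq α] (M : FinMatroid α) (part : α → ι)
    (I J : Finset α) (N : Finset (α × α)) : Prop :=
  WeaklyFeasible M I J N ∧
  (∀ u ∈ I \ J, ¬ M.Indep (insert u J) → ∃ p ∈ N, p.1 = u) ∧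
  (∀ p ∈ N, part p.1 = part p.2) ∧
  (∀ j : ι, (N.filter fun p => part p.1 = j).card =
    min (((I \ J).filter fun a => part a = j).card) (((J \ I).filter fun a => part a = j).card))

/-- `vote(I, J, N) = |{(u,v) ∈ N : u ≻ v}| - |{(u,v) ∈ N : v ≻ u}| + |I| - |J|`,
where `gt a b` means `a ≻ b`. -/
def voteN {α : Type*} (gt : α → α → Prop) (I J : Finset α) (N : Finset (α × α)) : ℤ :=
  ((N.filter fun p => gt p.1 p.2).card : ℤ) - ((N.filter fun p => gt p.2 p.1).card : ℤ)
    + (I.card : ℤ) - (J.card : ℤ)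

/-- `vote•(I, J)`: the minimum of `vote(I, J, N)` over weakly feasible pairings `N` for
`(I, J)`. -/
def voteB {α : Type*} [DecidableEq α] (M : FinMatroid α) (gt : α → α → Prop)
    (I J : Finset α) : ℤ :=
  sInf {z : ℤ | ∃ N : Finset (α × α), WeaklyFeasible M I J N ∧ z = voteN gt I J N}

/-- `vote(I, J)`: the minimum of `vote(I, J, N)` over feasible pairings `N` for `(I, J)`. -/
def voteF {α ι : Type*} [DecidableEq α] (M : FinMatroid α) (gt : α → α → Prop)
    (part : α → ι) (I J : Finset α) : ℤ :=
  sInf {z : ℤ | ∃ N : Finset (α × α), Feasible M part I J N ∧ z = voteN gt I J N}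

namespace FinMatroid

variable {α : Type*} [DecidableEq α] (M : FinMatroid α)

/-- An independent set can be enlarged, by elements of a larger independent set `J`, to an
independent set of the same size as `J`. -/
theorem exists_augment {I J : Finset α} (hI : M.Indep I) (hJ : M.Indep J)
    (h : I.card ≤ J.card) :
    ∃ K, I ⊆ K ∧ K ⊆ I ∪ J ∧ M.Indep K ∧ K.card = J.card := by
  induction hn : J.card - I.card generalizing I with
  | zero => exact ⟨I, Subset.rfl, subset_union_left, hI, by omega⟩
  | succ n ih =>
    obtain ⟨v, hv, hvI⟩ := M.indep_exchange hI hJ (by omega)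
    rw [mem_sdiff] at hv
    have hc := card_insert_of_notMem hv.2
    obtain ⟨K, h1, h2, h3, h4⟩ := ih hvI (by omega) (by omega)
    refine ⟨K, (subset_insert _ _).trans h1, fun x hx => ?_, h3, h4⟩
    have := h2 hx
    grind

/-- For two independent sets of the same size, the exchange graph contains a perfect matching
between the two differences. -/
theorem exists_perfect_pairing {I J : Finset α} (hI : M.Indep I) (hJ : M.Indep J)
    (h : I.card = J.card) :
    ∃ N : Finset (α × α), IsPairing I J N ∧
      (∀ p ∈ N, M.Indep (insert p.2 (I.erase p.1))) ∧
      (∀ v ∈ J \ I, ∃ p ∈ N, p.2 = v) ∧ (∀ u ∈ I \ J, ∃ p ∈ N, p.1 = u) ∧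
      N.card = (I \ J).card ∧ N.card = (J \ I).card := by
  let t : {v // v ∈ J \ I} → Finset α := fun v =>
    (I \ J).filter fun u => M.Indep (insert v.1 (I.erase u))
  have hIJ : (I \ J).card = (J \ I).card := by
    have := card_sdiff_add_card_inter I J
    have := card_sdiff_add_card_inter J I
    rw [inter_comm J I] at this
    omega
  have hall : ∀ X : Finset {v // v ∈ J \ I}, X.card ≤ (X.biUnion t).card := by
    intro X
    by_contra! hlt
    set T := X.biUnion t with hT
    have hTsub : T ⊆ I \ J := by
      intro u hu
      obtain ⟨v, -, hv⟩ := mem_biUnion.1 hu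
      exact (mem_filter.1 hv).1
    set X' := X.image Subtype.val with hX'
    have hX'c : X'.card = X.card := card_image_of_injective _ Subtype.val_injective
    have hX'sub : X' ⊆ J \ I := by
      intro v hv
      obtain ⟨w, -, rfl⟩ := mem_image.1 hv
      exact w.2
    have hA : M.Indep ((I ∩ J) ∪ T) := M.indep_subset (by grind) hI
    have hB : M.Indep ((I ∩ J) ∪ X') := M.indep_subset (by grind) hJ
    have hAc : ((I ∩ J) ∪ T).card = (I ∩ J).card + T.card :=
      card_union_of_disjoint (disjoint_left.2 (by grind))
    have hBc : ((I ∩ J) ∪ X').card = (I ∩ J).card + X'.card :=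
      card_union_of_disjoint (disjoint_left.2 (by grind))
    obtain ⟨v, hv, hvA⟩ := M.indep_exchange hA hB (by omega)
    have hvX : v ∈ X' := by grind
    have hvJ := hX'sub hvX
    rw [mem_sdiff] at hv hvJ
    have hBJ : ((I ∩ J) ∪ X').card ≤ J.card := card_le_card (by grind)
    obtain ⟨K, h1, h2, h3, h4⟩ := M.exists_augment hvA hI (by
      rw [card_insert_of_notMem hv.2]; omega)
    have hvK : v ∈ K := h1 (mem_insert_self _ _)
    have hnot : ¬ I ⊆ K := by
      intro hIK
      have : (insert v I).card ≤ K.card := card_le_card (by grind)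
      rw [card_insert_of_notMem hvJ.2] at this
      omega
    obtain ⟨u, huI, huK⟩ := not_subset.1 hnot
    have hKeq : insert v (I.erase u) = K := by
      symm
      apply eq_of_subset_of_card_le
      · intro x hx
        have := h2 hx
        grind
      · rw [card_insert_of_notMem (by grind), card_erase_of_mem huI, h4]
        have : 0 < I.card := card_pos.2 ⟨u, huI⟩
        omega
    have huT : u ∈ T := by
      obtain ⟨w, hw, rfl⟩ := mem_image.1 hvX
      refine mem_biUnion.2 ⟨w, hw, mem_filter.2 ⟨?_, hKeq ▸ h3⟩⟩
      grind
    grind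
  obtain ⟨f, hf, hft⟩ := (Finset.all_card_le_biUnion_card_iff_exists_injective t).1 hall
  have hft' : ∀ v, f v ∈ I \ J ∧ M.Indep (insert v.1 (I.erase (f v))) := fun v =>
    mem_filter.1 (hft v)
  let N : Finset (α × α) := univ.image fun v : {v // v ∈ J \ I} => (f v, v.1)
  have hN : ∀ p ∈ N, ∃ v : {v // v ∈ J \ I}, (f v, v.1) = p := fun p hp => by
    simpa [N] using hp
  have hNmem : ∀ v, (f v, v.1) ∈ N := fun v => mem_image_of_mem _ (mem_univ v)
  have hNc : N.card = (J \ I).card := by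
    rw [card_image_of_injective _ fun v w hvw => Subtype.ext (Prod.ext_iff.1 hvw).2]
    simp
  refine ⟨N, ⟨?_, ?_, ?_⟩, ?_, fun v hv => ⟨_, hNmem ⟨v, hv⟩, rfl⟩, ?_, hNc.trans hIJ.symm, hNc⟩
  · intro p hp
    obtain ⟨v, rfl⟩ := hN p hp
    exact ⟨(hft' v).1, v.2⟩
  · intro p hp q hq hpq
    obtain ⟨v, rfl⟩ := hN p hp
    obtain ⟨w, rfl⟩ := hN q hq
    rw [hf hpq]
  · intro p hp q hq hpq
    obtain ⟨v, rfl⟩ := hN p hp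
    obtain ⟨w, rfl⟩ := hN q hq
    rw [Subtype.ext hpq]
  · intro p hp
    obtain ⟨v, rfl⟩ := hN p hp
    exact (hft' v).2
  · have himg : univ.image f = I \ J := by
      apply eq_of_subset_of_card_le
      · intro u hu
        obtain ⟨v, -, rfl⟩ := mem_image.1 hu
        exact (hft' v).1
      · rw [card_image_of_injective _ hf, hIJ]
        simp
    intro u hu
    rw [← himg] at hu
    obtain ⟨v, -, rfl⟩ := mem_image.1 hu
    exact ⟨_, hNmem v, rfl⟩

/-- A pairing of maximum possible size that satisfies the covering conditions on both sides. -/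
theorem exists_maximum_pairing {I J : Finset α} (hI : M.Indep I) (hJ : M.Indep J) :
    ∃ N, WeaklyFeasible M I J N ∧
      (∀ u ∈ I \ J, ¬ M.Indep (insert u J) → ∃ p ∈ N, p.1 = u) ∧
      N.card = min (I \ J).card (J \ I).card := by
  have hIJ := card_sdiff_add_card_inter I J
  have hJI := card_sdiff_add_card_inter J I
  rw [inter_comm J I] at hJI
  rcases le_total I.card J.card with h | h
  · obtain ⟨K, h1, h2, h3, h4⟩ := M.exists_augment hI hJ h
    obtain ⟨N, ⟨p1, p2, p3⟩, n1, n2, n3, n4, n5⟩ := M.exists_perfect_pairing h3 hJ h4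
    have hK : K \ J = I \ J := by
      ext x
      have := @h1 x
      have := @h2 x
      grind
    rw [hK] at n3 n4
    refine ⟨N, ⟨⟨fun p hp => ?_, p2, p3⟩, fun p hp => ?_, fun v hv hd => ?_⟩,
      fun u hu _ => n3 u hu, by omega⟩
    · have := p1 p hp
      rw [hK] at this
      exact ⟨this.1, sdiff_subset_sdiff Subset.rfl h1 this.2⟩
    · exact M.indep_subset (insert_subset_insert _ (erase_subset_erase _ h1)) (n1 p hp)
    · refine n2 v (mem_sdiff.2 ⟨(mem_sdiff.1 hv).1, fun hvK => hd ?_⟩)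
      exact M.indep_subset (insert_subset hvK h1) h3
  · obtain ⟨K, h1, h2, h3, h4⟩ := M.exists_augment hJ hI h
    obtain ⟨N, ⟨p1, p2, p3⟩, n1, n2, n3, n4, n5⟩ := M.exists_perfect_pairing hI h3 h4.symm
    have hK : K \ I = J \ I := by
      ext x
      have := @h1 x
      have := @h2 x
      grind
    rw [hK] at n2 n5
    refine ⟨N, ⟨⟨fun p hp => ?_, p2, p3⟩, n1, fun v hv _ => n2 v hv⟩,
      fun u hu hd => ?_, by omega⟩
    · have := p1 p hp
      rw [hK] at this
      exact ⟨sdiff_subset_sdiff Subset.rfl h1 this.1, this.2⟩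
    · refine n3 u (mem_sdiff.2 ⟨(mem_sdiff.1 hu).1, fun huK => hd ?_⟩)
      exact M.indep_subset (insert_subset huK h1) h3

/-- In a direct sum, changing an independent set within one part only affects that part. -/
theorem indep_of_filter_part {ι : Type*} {M : FinMatroid α} {part : α → ι}
    (hd : ∀ X : Finset α, M.Indep X ↔ ∀ j : ι, M.Indep (X.filter fun a => part a = j))
    {I Y : Finset α} (hI : M.Indep I) {j : ι}
    (hj : M.Indep (Y.filter fun a => part a = j)) (hY : ∀ a ∈ Y, part a ≠ j → a ∈ I) :
    M.Indep Y := by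
  rw [hd]
  intro k
  rcases eq_or_ne k j with rfl | hk
  · exact hj
  · refine M.indep_subset (fun a ha => ?_) hI
    rw [mem_filter] at ha
    exact hY a ha.1 (ha.2 ▸ hk)

theorem exists_feasible {ι : Type*} [Fintype α] {M : FinMatroid α} {part : α → ι}
    (hd : ∀ X : Finset α, M.Indep X ↔ ∀ j : ι, M.Indep (X.filter fun a => part a = j))
    {I J : Finset α} (hI : M.Indep I) (hJ : M.Indep J) :
    ∃ N, Feasible M part I J N := by
  let res : Finset α → ι → Finset α := fun X j => X.filter fun a => part a = j
  have hres : ∀ X j a, a ∈ res X j ↔ a ∈ X ∧ part a = j := fun X j a => mem_filter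
  choose P hP hP3 hPc using fun j => M.exists_maximum_pairing ((hd I).1 hI j) ((hd J).1 hJ j)
  change ∀ j, WeaklyFeasible M (res I j) (res J j) (P j) at hP
  change ∀ j, ∀ u ∈ res I j \ res J j, ¬ M.Indep (insert u (res J j)) → _ at hP3
  let N : Finset (α × α) := univ.filter fun p => p ∈ P (part p.1)
  have hN : ∀ p, p ∈ N ↔ p ∈ P (part p.1) := fun p => by simp [N]
  have hmem : ∀ j, ∀ p ∈ P j, p.1 ∈ I \ J ∧ p.2 ∈ J \ I ∧ part p.1 = j ∧ part p.2 = j := by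
    intro j p hp
    have := (hP j).1.1 p hp
    simp only [mem_sdiff, hres] at this ⊢
    tauto
  have hmemN : ∀ j, ∀ p ∈ P j, p ∈ N := fun j p hp => by
    rw [hN, (hmem j p hp).2.2.1]; exact hp
  have hins : ∀ {X : Finset α} {x : α}, M.Indep X → ¬ M.Indep (insert x X) →
      ¬ M.Indep (insert x (res X (part x))) := by
    intro X x hX hx hx'
    refine hx (indep_of_filter_part hd hX (j := part x) ?_ (by grind))
    convert hx' using 1
    ext a
    simp only [mem_filter, mem_insert, hres]
    grind
  refine ⟨N, ⟨⟨fun p hp => ?_, fun p hp q hq hpq => ?_, fun p hp q hq hpq => ?_⟩,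
    fun p hp => ?_, fun v hv hdep => ?_⟩, fun u hu hdep => ?_, fun p hp => ?_, fun j => ?_⟩
  · have := hmem _ p ((hN p).1 hp)
    exact ⟨this.1, this.2.1⟩
  · rw [hN] at hp hq
    rw [← hpq] at hq
    exact (hP _).1.2.1 p hp q hq hpq
  · rw [hN] at hp hq
    have h1 := (hmem _ p hp).2.2.2
    have h2 := (hmem _ q hq).2.2.2
    rw [← h2, ← hpq, h1] at hq
    exact (hP _).1.2.2 p hp q hq hpq
  · rw [hN] at hp
    have h1 := (hP _).2.1 p hp
    have h2 := (hmem _ p hp).2.2.2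
    refine indep_of_filter_part hd hI (j := part p.1) (M.indep_subset ?_ h1) (by grind)
    intro a
    simp only [mem_filter, mem_insert, mem_erase, hres]
    grind
  · obtain ⟨p, hp, rfl⟩ := (hP (part v)).2.2 v (by simp only [mem_sdiff, hres] at hv ⊢; tauto)
      (hins hI hdep)
    exact ⟨p, hmemN _ p hp, rfl⟩
  · obtain ⟨p, hp, rfl⟩ := hP3 (part u) u (by simp only [mem_sdiff, hres] at hu ⊢; tauto)
      (hins hJ hdep)
    exact ⟨p, hmemN _ p hp, rfl⟩
  · have := hmem _ p ((hN p).1 hp)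
    exact this.2.2.2.symm
  · have hNj : (N.filter fun p => part p.1 = j) = P j := by
      ext p
      rw [mem_filter, hN]
      constructor
      · rintro ⟨hp, rfl⟩
        exact hp
      · intro hp
        have := (hmem j p hp).2.2.1
        exact ⟨this.symm ▸ hp, this⟩
    have hsd : ∀ X Y : Finset α, res (X \ Y) j = res X j \ res Y j := by
      intro X Y
      ext a
      simp only [mem_sdiff, hres]
      tauto
    rw [hNj, hPc j]
    exact congrArg₂ min (congrArg card (hsd I J).symm) (congrArg card (hsd J I).symm)

theorem exists_feasible_voteF_eq {ι : Type*} [Fintype α] {M : FinMatroid α} {part : α → ι}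
    (gt : α → α → Prop)
    (hd : ∀ X : Finset α, M.Indep X ↔ ∀ j : ι, M.Indep (X.filter fun a => part a = j))
    {I J : Finset α} (hI : M.Indep I) (hJ : M.Indep J) :
    ∃ N, Feasible M part I J N ∧ voteF M gt part I J = voteN gt I J N := by
  obtain ⟨N, hN⟩ := exists_feasible hd hI hJ
  refine Int.csInf_mem (s := {z | ∃ N, Feasible M part I J N ∧ z = voteN gt I J N})
    ⟨_, N, hN, rfl⟩ (Set.Finite.bddBelow ?_)
  refine (Set.finite_range (voteN gt I J)).subset ?_
  rintro z ⟨N, -, rfl⟩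
  exact ⟨N, rfl⟩

/-- `v` is spanned by elements of `A` that are preferred to `v`. -/
def Dominated (gt : α → α → Prop) (A : Set α) (v : α) : Prop :=
  ∃ Z : Finset α, (∀ z ∈ Z, z ∈ A ∧ gt z v) ∧ M.Indep Z ∧ ¬ M.Indep (insert v Z)

theorem Dominated.mono {M : FinMatroid α} {gt : α → α → Prop} {A B : Set α} (hAB : A ⊆ B)
    {v : α} (h : M.Dominated gt A v) : M.Dominated gt B v := by
  obtain ⟨Z, hZ, h⟩ := h
  exact ⟨Z, fun z hz => ⟨hAB (hZ z hz).1, (hZ z hz).2⟩, h⟩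

/-- The greedily optimal basis of `A`. -/
def greedy [Fintype α] (gt : α → α → Prop) (A : Set α) : Finset α :=
  univ.filter fun v => v ∈ A ∧ ¬ M.Dominated gt A v

variable [Fintype α] {gt : α → α → Prop}

theorem mem_greedy {A : Set α} {v : α} :
    v ∈ M.greedy gt A ↔ v ∈ A ∧ ¬ M.Dominated gt A v := by
  simp [greedy]

theorem indep_greedy (hgt : IsStrictTotalOrder α gt) (A : Set α) :
    M.Indep (M.greedy gt A) := by
  by_contra hdep
  obtain ⟨Z, hZsub, hZ⟩ := exists_minimal_le_of_wellFoundedLT (fun Z => ¬ M.Indep Z) _ hdep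
  have hne : Z.Nonempty := by
    rw [nonempty_iff_ne_empty]
    rintro rfl
    obtain ⟨I, hI⟩ := M.exists_indep
    exact hZ.1 (M.indep_subset (empty_subset I) hI)
  have wf : WellFounded (Function.swap gt) := Finite.wellFounded_of_trans_of_irrefl _
  obtain ⟨v, hvZ, hv⟩ := wf.has_min (Z : Set α) hne
  refine ((M.mem_greedy).1 (hZsub hvZ)).2 ⟨Z.erase v, fun z hz => ?_, ?_, ?_⟩
  · rw [mem_erase] at hz
    refine ⟨((M.mem_greedy).1 (hZsub hz.2)).1, ?_⟩
    rcases trichotomous_of gt z v with h | h | h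
    · exact h
    · exact absurd h hz.1
    · exact absurd h (hv z hz.2)
  · by_contra hd
    have := hZ.2 hd (erase_subset v Z) hvZ
    exact notMem_erase v Z this
  · rw [insert_erase hvZ]
    exact hZ.1

/-- Every element spanned by preferred elements of `A` is spanned by preferred elements of the
greedy basis of `A`. -/
theorem Dominated.not_indep_insert_greedy {M : FinMatroid α} (hgt : IsStrictTotalOrder α gt)
    {A : Set α} {v : α} (h : M.Dominated gt A v) :
    ¬ M.Indep (insert v ((M.greedy gt A).filter fun u => gt u v)) := by
  have wf : WellFounded gt := Finite.wellFounded_of_trans_of_irrefl _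
  induction v using wf.induction with
  | _ v ih =>
  intro hind
  obtain ⟨Z, hZA, hZ, hvZ⟩ := h
  set B := (M.greedy gt A).filter fun u => gt u v with hB
  have hBA : ∀ b ∈ B, b ∈ A ∧ gt b v := fun b hb =>
    ⟨((M.mem_greedy).1 (mem_filter.1 hb).1).1, (mem_filter.1 hb).2⟩
  have hBi : M.Indep B := M.indep_subset (subset_insert _ _) hind
  have hvB : v ∉ B := fun hv => irrefl_of gt v (hBA v hv).2
  obtain ⟨Z', hZZ', hmax⟩ := exists_maximal_ge_of_wellFoundedGT
    (fun Z => (∀ z ∈ Z, z ∈ A ∧ gt z v) ∧ M.Indep Z) Z ⟨hZA, hZ⟩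
  have hle : (insert v B).card ≤ Z'.card := by
    by_contra! hlt
    obtain ⟨w, hw, hwi⟩ := M.indep_exchange hmax.1.2 hind hlt
    rw [mem_sdiff, mem_insert] at hw
    rcases hw with ⟨rfl | hwB, hwZ⟩
    · exact hvZ (M.indep_subset (insert_subset_insert _ hZZ') hwi)
    · refine hwZ (hmax.2 ⟨fun z hz => ?_, hwi⟩ (subset_insert _ _) (mem_insert_self w Z'))
      rcases mem_insert.1 hz with rfl | hz
      · exact hBA z hwB
      · exact hmax.1.1 z hz
  rw [card_insert_of_notMem hvB] at hle
  obtain ⟨x, hx, hxi⟩ := M.indep_exchange hBi hmax.1.2 hle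
  rw [mem_sdiff] at hx
  obtain ⟨hxA, hxv⟩ := hmax.1.1 x hx.1
  have hxD : M.Dominated gt A x := by
    by_contra hxD
    exact hx.2 (mem_filter.2 ⟨(M.mem_greedy).2 ⟨hxA, hxD⟩, hxv⟩)
  refine ih x hxv hxD (M.indep_subset (insert_subset_insert _ fun u hu => ?_) hxi)
  rw [mem_filter] at hu
  exact mem_filter.2 ⟨hu.1, trans_of gt hu.2 hxv⟩

/-- Existence of a matroid kernel (stable common independent set). -/
theorem exists_kernel (M₁ M₂ : FinMatroid α) {gt₁ gt₂ : α → α → Prop}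
    (h₁ : IsStrictTotalOrder α gt₁) (h₂ : IsStrictTotalOrder α gt₂) :
    ∃ I : Finset α, M₁.Indep I ∧ M₂.Indep I ∧ ∀ v ∉ I,
      ¬ M₁.Indep (insert v (I.filter fun u => gt₁ u v)) ∨
      ¬ M₂.Indep (insert v (I.filter fun u => gt₂ u v)) := by
  let keep : FinMatroid α → (α → α → Prop) → Set α → Set α := fun M gt A =>
    {v | ¬ (v ∈ A ∧ M.Dominated gt A v)}
  have hkeep : ∀ M gt, Antitone (keep M gt) := fun M gt A B hAB v hv hvA =>
    hv ⟨hAB hvA.1, hvA.2.mono hAB⟩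
  let f : Set α →o Set α :=
    ⟨fun A => keep M₂ gt₂ (keep M₁ gt₁ A), fun A B hAB => hkeep _ _ (hkeep _ _ hAB)⟩
  obtain ⟨A, B, hB, hA⟩ : ∃ A B, keep M₁ gt₁ A = B ∧ keep M₂ gt₂ B = A :=
    ⟨f.lfp, _, rfl, f.map_lfp⟩
  have hB' : ∀ v, v ∈ B ↔ ¬ (v ∈ A ∧ M₁.Dominated gt₁ A v) := fun v => by
    rw [← hB]; rfl
  have hA' : ∀ v, v ∈ A ↔ ¬ (v ∈ B ∧ M₂.Dominated gt₂ B v) := fun v => by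
    conv_lhs => rw [← hA]
    rfl
  have heq : M₁.greedy gt₁ A = M₂.greedy gt₂ B := by
    ext v
    rw [mem_greedy, mem_greedy]
    have := hA' v
    have := hB' v
    tauto
  refine ⟨M₁.greedy gt₁ A, M₁.indep_greedy h₁ A, heq ▸ M₂.indep_greedy h₂ B, fun v hv => ?_⟩
  by_cases hvD : v ∈ A ∧ M₁.Dominated gt₁ A v
  · exact Or.inl (hvD.2.not_indep_insert_greedy h₁)
  · right
    rw [heq] at hv ⊢
    rw [mem_greedy] at hv
    have hvB := (hB' v).2 hvD
    exact Dominated.not_indep_insert_greedy h₂ (by tauto)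

end FinMatroid

section Counting

variable {α : Type*} [DecidableEq α] {M : FinMatroid α} {gt : α → α → Prop}
  {I J : Finset α} {N : Finset (α × α)}

theorem IsPairing.card_le (hN : IsPairing I J N) : N.card ≤ (I \ J).card :=
  card_le_card_of_injOn Prod.fst (fun p hp => (hN.1 p hp).1) fun p hp q hq h => hN.2.1 p hp q hq h

/-- The elements of `J \ I` spanned by preferred elements of `I` all vote for `I`. -/
theorem WeaklyFeasible.card_dominated_le
    (hN : WeaklyFeasible M I J N) :
    ((J \ I).filter fun v => ¬ M.Indep (insert v (I.filter fun u => gt u v))).card ≤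
      (N.filter fun p => gt p.1 p.2).card := by
  refine (card_le_card fun v hv => ?_).trans (card_image_le (f := Prod.snd))
  rw [mem_filter] at hv
  obtain ⟨hv, hdep⟩ := hv
  obtain ⟨p, hp, rfl⟩ := hN.2.2 v hv fun h =>
    hdep (M.indep_subset (insert_subset_insert _ (filter_subset _ _)) h)
  refine mem_image.2 ⟨p, mem_filter.2 ⟨hp, ?_⟩, rfl⟩
  by_contra hgtp
  refine hdep (M.indep_subset (insert_subset_insert _ fun u hu => ?_) (hN.2.1 p hp))
  rw [mem_filter] at hu
  refine mem_erase.2 ⟨?_, hu.1⟩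
  rintro rfl
  exact hgtp hu.2

theorem IsPairing.card_filter_add (hgt : IsStrictTotalOrder α gt) (hN : IsPairing I J N) :
    (N.filter fun p => gt p.1 p.2).card + (N.filter fun p => gt p.2 p.1).card = N.card := by
  rw [← card_filter_add_card_filter_not (s := N) (fun p => gt p.1 p.2)]
  congr 2
  refine filter_congr fun p hp => ⟨fun h h' => asymm_of gt h h', fun h => ?_⟩
  have hp := hN.1 p hp
  rcases trichotomous_of gt p.1 p.2 with h' | h' | h'
  · exact absurd h' h
  · rw [h', mem_sdiff, mem_sdiff] at hp
    exact absurd hp.2.1 hp.1.2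
  · exact h'

end Counting

/-- for ordered matroids `M₁`, `M₂` on the same finite ground set, each presented
as a direct sum along partitions `part₁`, `part₂`, there exists a popular common independent
set: an `I ∈ 𝓘₁ ∩ 𝓘₂` with `vote₁(I,J) + vote₂(I,J) ≥ 0` for every `J ∈ 𝓘₁ ∩ 𝓘₂`.
(`gtᵢ a b` means `a ≻ᵢ b`.) -/
theorem stmt_9 {α ι₁ ι₂ : Type*} [DecidableEq α] [Fintype α]
    (M₁ M₂ : FinMatroid α) (gt₁ gt₂ : α → α → Prop)
    (h₁ : IsStrictTotalOrder α gt₁) (h₂ : IsStrictTotalOrder α gt₂)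
    (part₁ : α → ι₁) (part₂ : α → ι₂)
    (hdsum₁ : ∀ X : Finset α, M₁.Indep X ↔ ∀ j : ι₁, M₁.Indep (X.filter fun a => part₁ a = j))
    (hdsum₂ : ∀ X : Finset α, M₂.Indep X ↔ ∀ j : ι₂, M₂.Indep (X.filter fun a => part₂ a = j)) :
    ∃ I : Finset α, M₁.Indep I ∧ M₂.Indep I ∧
      ∀ J, M₁.Indep J → M₂.Indep J →
        0 ≤ voteF M₁ gt₁ part₁ I J + voteF M₂ gt₂ part₂ I J := by
  obtain ⟨I, hI₁, hI₂, hI⟩ := FinMatroid.exists_kernel M₁ M₂ h₁ h₂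
  refine ⟨I, hI₁, hI₂, fun J hJ₁ hJ₂ => ?_⟩
  obtain ⟨N₁, hN₁, e₁⟩ := FinMatroid.exists_feasible_voteF_eq gt₁ hdsum₁ hI₁ hJ₁
  obtain ⟨N₂, hN₂, e₂⟩ := FinMatroid.exists_feasible_voteF_eq gt₂ hdsum₂ hI₂ hJ₂
  have c₁ := hN₁.1.1.card_le
  have c₂ := hN₂.1.1.card_le
  have s₁ := hN₁.1.1.card_filter_add h₁
  have s₂ := hN₂.1.1.card_filter_add h₂
  have d₁ := hN₁.1.card_dominated_le (gt := gt₁)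
  have d₂ := hN₂.1.card_dominated_le (gt := gt₂)
  have hcover : (J \ I).card ≤
      ((J \ I).filter fun v => ¬ M₁.Indep (insert v (I.filter fun u => gt₁ u v))).card +
      ((J \ I).filter fun v => ¬ M₂.Indep (insert v (I.filter fun u => gt₂ u v))).card := by
    refine (card_le_card fun v hv => ?_).trans (card_union_le _ _)
    rw [mem_union, mem_filter, mem_filter]
    have := hI v (mem_sdiff.1 hv).2
    tauto
  have hIJ := card_sdiff_add_card_inter I J
  have hJI := card_sdiff_add_card_inter J I
  rw [inter_comm J I] at hJI
  rw [e₁, e₂, voteN, voteN]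
  omega

end
end

section
/- Let M_1 = (S, 𝓘_1, ≻_1) and M_2 = (S, 𝓘_2, ≻_2) be ordered matroids on the same finite ground set S, each given as a direct sum of matroids on disjoint parts of S. Then there exists a maximum-size popular common independent set: a common independent set I ∈ 𝓘_1 ∩ 𝓘_2 that is popular (vote_1(I,J) + vote_2(I,J) ≥ 0 for every J ∈ 𝓘_1 ∩ 𝓘_2) and satisfies |J| ≤ |I| for every popular common independent set J ∈ 𝓘_1 ∩ 𝓘_2. -/
open Finset
open scoped Classical

noncomputable section

namespace FinMatroid

variable {α : Type*} [DecidableEq α]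

/-- The Mathlib matroid with the same independent sets. -/
def toMatroid (M : FinMatroid α) : Matroid α :=
  (IndepMatroid.ofFinset Set.univ M.Indep
    (M.exists_indep.elim fun _ h => M.indep_subset (empty_subset _) h)
    (fun _ _ hJ h => M.indep_subset h hJ)
    (fun _ _ hI hJ h => by
      obtain ⟨v, hv, hvI⟩ := M.indep_exchange hI hJ h
      exact ⟨v, (mem_sdiff.1 hv).1, (mem_sdiff.1 hv).2, hvI⟩)
    (fun _ _ => Set.subset_univ _)).matroid

@[simp] lemma toMatroid_E (M : FinMatroid α) : M.toMatroid.E = Set.univ := rfl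

@[simp] lemma toMatroid_indep (M : FinMatroid α) {I : Finset α} :
    M.toMatroid.Indep (I : Set α) ↔ M.Indep I := by
  rw [toMatroid, IndepMatroid.matroid_Indep, IndepMatroid.ofFinset_indep]

/-- Symmetric exchange for independent sets of equal size. -/
lemma symmetric_exchange (M : FinMatroid α) {I J : Finset α} (hI : M.Indep I) (hJ : M.Indep J)
    (hcard : I.card = J.card) {v : α} (hv : v ∈ J \ I) :
    ∃ u ∈ I \ J, M.Indep (insert v (I.erase u)) ∧ M.Indep (insert u (J.erase v)) := by
  obtain ⟨hvJ, hvI⟩ := mem_sdiff.1 hv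
  by_cases hvi : M.Indep (insert v I)
  · obtain ⟨u, hu, hui⟩ := M.indep_exchange (M.indep_subset (erase_subset v J) hJ) hI
      (by rw [hcard]; exact card_erase_lt_of_mem hvJ)
    have huv : u ≠ v := by rintro rfl; simp_all
    refine ⟨u, by simp_all, M.indep_subset (insert_subset_insert _ (erase_subset _ _)) hvi, hui⟩
  · have hI' := M.toMatroid_indep.2 hI
    have hJ' := M.toMatroid_indep.2 hJ
    have hvcl : v ∈ M.toMatroid.closure (I : Set α) := by
      by_contra hcl
      exact hvi (M.toMatroid_indep.1 (by
        rw [coe_insert, Matroid.insert_indep_iff]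
        exact ⟨hI', fun _ => ⟨by simp, hcl⟩⟩))
    have hcirc := hI'.fundCircuit_isCircuit hvcl (by simpa using hvI)
    obtain ⟨u, hu, hucl⟩ : ∃ u ∈ M.toMatroid.fundCircuit v I \ {v},
        u ∉ M.toMatroid.closure ((J : Set α) \ {v}) := by
      by_contra! hall
      exact hJ'.notMem_closure_sdiff_of_mem (by simpa using hvJ)
        (M.toMatroid.closure_subset_closure_of_subset_closure hall
          (hcirc.mem_closure_sdiff_singleton_of_mem (M.toMatroid.mem_fundCircuit v I)))
    have huv : u ≠ v := hu.2
    have huI : u ∈ I := by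
      have := M.toMatroid.fundCircuit_subset_insert v I hu.1
      simpa [huv] using this
    have huJ : u ∉ J := fun h =>
      hucl (M.toMatroid.subset_closure _ (by simp) ⟨by simpa using h, huv⟩)
    refine ⟨u, by simp [huI, huJ], ?_, ?_⟩
    · have := (hI'.mem_fundCircuit_iff hvcl (by simpa using hvI)).1 hu.1
      rw [← M.toMatroid_indep]
      refine this.subset ?_
      intro x
      simp only [coe_insert, coe_erase, Set.mem_insert_iff, Set.mem_sdiff, Set.mem_singleton_iff]
      grind
    · rw [← M.toMatroid_indep, coe_insert, coe_erase, Matroid.insert_indep_iff]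
      exact ⟨hJ'.subset Set.sdiff_subset, fun _ => ⟨by simp, hucl⟩⟩

end FinMatroid

section Kernel

variable {β : Type*}

/-- The elements of `X` spanned by the elements of `X` with larger key. -/
def rejected (M : Matroid β) (r : β → ℕ) (X : Set β) : Set β :=
  {e ∈ X | e ∈ M.closure {f ∈ X | r e < r f}}

lemma rejected_mono (M : Matroid β) (r : β → ℕ) : Monotone (rejected M r) := fun _ _ h _ he =>
  ⟨h he.1, M.closure_subset_closure (fun _ hf => Set.mem_sep (h hf.1) hf.2) he.2⟩

lemma indep_sdiff_rejected (M : Matroid β) [M.Finite] (hE : M.E = Set.univ) {r : β → ℕ}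
    (hr : Function.Injective r) (X : Set β) : M.Indep (X \ rejected M r X) := by
  by_contra hdep
  obtain ⟨C, hCX, hC⟩ :=
    ((Matroid.not_indep_iff (by rw [hE]; exact Set.subset_univ _)).1 hdep).exists_isCircuit_subset
  obtain ⟨e, heC, hmin⟩ := Set.exists_min_image C r (M.set_finite C hC.subset_ground) hC.nonempty
  have heX := hCX heC
  refine heX.2 ⟨heX.1, M.closure_subset_closure ?_ (hC.mem_closure_sdiff_singleton_of_mem heC)⟩
  rintro f ⟨hf, hfe⟩
  exact ⟨(hCX hf).1, (hmin f hf).lt_of_ne fun h => hfe (hr h).symm⟩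

lemma mem_closure_of_mem_rejected [Finite β] (M : Matroid β) (hE : M.E = Set.univ) (r : β → ℕ)
    {X : Set β} {e : β} (he : e ∈ rejected M r X) :
    e ∈ M.closure {f ∈ X \ rejected M r X | r e < r f} := by
  have hwf : WellFounded fun a b : β => r b < r a :=
    @Finite.wellFounded_of_trans_of_irrefl β _ _ ⟨fun _ _ _ h h' => lt_trans h' h⟩
      ⟨fun _ => lt_irrefl _⟩
  induction e using hwf.induction with
  | _ e ih =>
    refine M.closure_subset_closure_of_subset_closure ?_ he.2
    rintro f ⟨hfX, hef⟩
    by_cases hf : f ∈ rejected M r X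
    · refine M.closure_subset_closure ?_ (ih f hef hf)
      exact fun g hg => ⟨hg.1, hef.trans hg.2⟩
    · exact M.subset_closure _ (by rw [hE]; exact Set.subset_univ _) ⟨⟨hfX, hf⟩, hef⟩

/-- Two matroids with injective keys on a common finite ground set have a kernel. -/
lemma exists_matroid_kernel [Finite β] (M₁ M₂ : Matroid β) (hE₁ : M₁.E = Set.univ)
    (hE₂ : M₂.E = Set.univ) {r₁ r₂ : β → ℕ} (hr₁ : Function.Injective r₁)
    (hr₂ : Function.Injective r₂) :
    ∃ K : Set β, M₁.Indep K ∧ M₂.Indep K ∧ ∀ e ∉ K,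
      e ∈ M₁.closure {f ∈ K | r₁ e < r₁ f} ∨ e ∈ M₂.closure {f ∈ K | r₂ e < r₂ f} := by
  have : M₁.Finite := ⟨Set.toFinite _⟩
  have : M₂.Finite := ⟨Set.toFinite _⟩
  let F : Set β →o Set β := ⟨fun X => (rejected M₂ r₂ (rejected M₁ r₁ X)ᶜ)ᶜ, fun X Y h =>
    Set.compl_subset_compl.2 (rejected_mono _ _ (Set.compl_subset_compl.2
      (rejected_mono _ _ h)))⟩
  obtain ⟨X, hX⟩ : ∃ X, F X = X := ⟨F.lfp, F.map_lfp⟩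
  set Y := (rejected M₁ r₁ X)ᶜ with hY
  have hX' : X = (rejected M₂ r₂ Y)ᶜ := hX.symm
  have hK : X \ rejected M₁ r₁ X = Y \ rejected M₂ r₂ Y := by
    rw [Set.sdiff_eq, Set.sdiff_eq, ← hY, ← hX', Set.inter_comm]
  refine ⟨X \ rejected M₁ r₁ X, indep_sdiff_rejected M₁ hE₁ hr₁ X,
    hK ▸ indep_sdiff_rejected M₂ hE₂ hr₂ Y, fun e he => ?_⟩
  by_cases heX : e ∈ X
  · exact Or.inl (mem_closure_of_mem_rejected M₁ hE₁ r₁ (by by_contra h; exact he ⟨heX, h⟩))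
  · right
    rw [hK]
    exact mem_closure_of_mem_rejected M₂ hE₂ r₂ (by by_contra h; exact heX (hX' ▸ h))

end Kernel

section Domination

variable {α : Type*}

/-- The key of the copy of `a` on level `c`: copies on the level `best` precede all others, and
copies on the same level are compared by `rk`. -/
def levelKey (n : ℕ) (rk : α → ℕ) (best : Bool) (e : α × Bool) : ℕ :=
  rk e.1 + if e.2 = best then n else 0

lemma levelKey_injective {n : ℕ} {rk : α → ℕ} (hinj : Function.Injective rk)
    (hlt : ∀ a, rk a < n) (best : Bool) : Function.Injective (levelKey n rk best) := by
  rintro ⟨a, c⟩ ⟨b, d⟩ h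
  have ha := hlt a
  have hb := hlt b
  simp only [levelKey] at h
  have hcd : c = d := by
    by_cases hc : c = best <;> by_cases hd : d = best <;> simp only [hc, hd, if_true, if_false] at h
    · rw [hc, hd]
    · omega
    · omega
    · cases c <;> cases d <;> cases best <;> simp_all
  subst hcd
  rw [hinj (Nat.add_right_cancel h)]

variable [DecidableEq α]

/-- The copy `(v, c)` is dominated by the independent set `I` with levels `lev`: `v` is spanned
by `I`, and every element of `I` that can be exchanged for `v` has a key at least as large. -/
def Dominated (M : FinMatroid α) (key : α × Bool → ℕ) (I : Finset α) (lev : α → Bool)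
    (v : α) (c : Bool) : Prop :=
  ¬ M.Indep (insert v I) ∧
    ∀ u ∈ I, M.Indep (insert v (I.erase u)) → key (v, c) ≤ key (u, lev u)

lemma not_indep_of_mem_comap_closure (M : FinMatroid α) {K A : Set (α × Bool)}
    (hK : (M.toMatroid.comap Prod.fst).Indep K) (hAK : A ⊆ K) {v : α} {c : Bool}
    (hv : ∀ d, (v, d) ∉ K) (hcl : (v, c) ∈ (M.toMatroid.comap Prod.fst).closure A)
    {X : Finset α} (hvX : v ∈ X) (hAX : ∀ e ∈ A, e.1 ∈ X) : ¬ M.Indep X := by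
  intro hX
  have hind : (M.toMatroid.comap Prod.fst).Indep (insert (v, c) A) := by
    refine Matroid.comap_indep_iff.2 ⟨(M.toMatroid_indep.2 hX).subset ?_, ?_⟩
    · rintro _ ⟨e, rfl | he, rfl⟩
      · exact hvX
      · exact hAX e he
    · refine (Set.injOn_insert fun h => hv c (hAK h)).2
        ⟨(Matroid.comap_indep_iff.1 hK).2.mono hAK, ?_⟩
      rintro ⟨⟨a, d⟩, he, rfl⟩
      exact hv d (hAK he)
  exact ((Matroid.insert_indep_iff.1 hind).2 fun h => hv c (hAK h)).2 hcl

lemma exists_dominating_common_indep [Fintype α] (M₁ M₂ : FinMatroid α)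
    {key₁ key₂ : α × Bool → ℕ} (h₁ : Function.Injective key₁) (h₂ : Function.Injective key₂) :
    ∃ (I : Finset α) (lev : α → Bool), M₁.Indep I ∧ M₂.Indep I ∧
      ∀ v ∉ I, ∀ c, Dominated M₁ key₁ I lev v c ∨ Dominated M₂ key₂ I lev v c := by
  obtain ⟨K, hK₁, hK₂, hdom⟩ := exists_matroid_kernel (M₁.toMatroid.comap Prod.fst)
    (M₂.toMatroid.comap Prod.fst) (by simp) (by simp) h₁ h₂
  let I : Finset α := univ.filter fun a => ∃ c, (a, c) ∈ K
  let lev : α → Bool := fun a => decide ((a, true) ∈ K)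
  have hinj := (Matroid.comap_indep_iff.1 hK₁).2
  have hlev : ∀ e ∈ K, lev e.1 = e.2 := by
    rintro ⟨a, c⟩ he
    cases c with
    | true => exact decide_eq_true he
    | false => exact decide_eq_false fun h => by simpa using hinj h he rfl
  have himage : Prod.fst '' K = (I : Set α) := by ext a; simp [I]
  have key_lemma : ∀ (M : FinMatroid α) (key : α × Bool → ℕ) (v : α) (c : Bool), v ∉ I →
      (M.toMatroid.comap Prod.fst).Indep K →
      (v, c) ∈ (M.toMatroid.comap Prod.fst).closure {f ∈ K | key (v, c) < key f} →
      Dominated M key I lev v c := by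
    intro M key v c hvI hK hcl
    have hv : ∀ d, (v, d) ∉ K := fun d hd => hvI (by simp only [I, mem_filter_univ]; exact ⟨d, hd⟩)
    have hsub : {f ∈ K | key (v, c) < key f} ⊆ K := Set.sep_subset _ _
    have hmem : ∀ e ∈ K, e.1 ∈ I := fun e he => by
      simp only [I, mem_filter_univ]; exact ⟨e.2, he⟩
    refine ⟨not_indep_of_mem_comap_closure M hK hsub hv hcl (mem_insert_self _ _)
      fun e he => mem_insert_of_mem (hmem e he.1), fun u _ hui => ?_⟩
    by_contra! hlt
    refine not_indep_of_mem_comap_closure M hK hsub hv hcl (mem_insert_self _ _)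
      (fun e he => mem_insert_of_mem (mem_erase.2 ⟨?_, hmem e he.1⟩)) hui
    rintro rfl
    have := he.2
    rw [hlev e he.1] at hlt
    exact absurd this (not_lt.2 hlt.le)
  refine ⟨I, lev, ?_, ?_, fun v hv c => ?_⟩
  · rw [← M₁.toMatroid_indep, ← himage]
    exact (Matroid.comap_indep_iff.1 hK₁).1
  · rw [← M₂.toMatroid_indep, ← himage]
    exact (Matroid.comap_indep_iff.1 hK₂).1
  · have hvK : (v, c) ∉ K := fun h => hv (by simp only [I, mem_filter_univ]; exact ⟨c, h⟩)
    exact (hdom _ hvK).imp (key_lemma M₁ key₁ v c hv hK₁) (key_lemma M₂ key₂ v c hv hK₂)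

end Domination

section Pairings

variable {α ι : Type*} [DecidableEq α]

lemma FinMatroid.indep_of_indep_filter {M : FinMatroid α} {part : α → ι}
    (hds : ∀ X : Finset α, M.Indep X ↔ ∀ j : ι, M.Indep (X.filter fun a => part a = j))
    {I X : Finset α} (hI : M.Indep I) {j : ι} (hXI : ∀ a ∈ X, part a ≠ j → a ∈ I)
    (hX : M.Indep (X.filter fun a => part a = j)) : M.Indep X := by
  rw [hds]
  intro k
  by_cases hk : k = j
  · exact hk ▸ hX
  · refine M.indep_subset (fun a ha => ?_) hI
    obtain ⟨haX, rfl⟩ := mem_filter.1 ha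
    exact hXI a haX hk

lemma card_filter_add_card_filter_sdiff (I J : Finset α) (p : α → Prop) :
    (I.filter p).card + ((J \ I).filter p).card = (J.filter p).card + ((I \ J).filter p).card := by
  have hI : I.filter p = (I ∩ J).filter p ∪ (I \ J).filter p := by ext; grind
  have hJ : J.filter p = (I ∩ J).filter p ∪ (J \ I).filter p := by ext; grind
  rw [hI, hJ, card_union_of_disjoint, card_union_of_disjoint]
  · omega
  all_goals exact disjoint_left.2 fun a => by grind

lemma IsPairing.card_filter_fst {I J : Finset α} {N : Finset (α × α)} (hN : IsPairing I J N)
    (hcov : ∀ u ∈ I \ J, ∃ p ∈ N, p.1 = u) (q : α → Prop) :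
    (N.filter fun p => q p.1).card = ((I \ J).filter q).card := by
  refine card_nbij Prod.fst ?_ ?_ ?_
  · intro p hp
    have := hN.1 p
    grind
  · intro p hp p' hp' h
    simp only [coe_filter, Set.mem_ofPred_eq] at hp hp'
    exact hN.2.1 p hp.1 p' hp'.1 h
  · intro u hu
    simp only [coe_filter, Set.mem_ofPred_eq] at hu
    obtain ⟨p, hp, rfl⟩ := hcov u hu.1
    exact ⟨p, by simp [hp, hu.2], rfl⟩

/-- If `I` and `J` have equally many elements in every summand, and every exchange of an
element of `I` for an element `v` of `J` leaves an element of rank at least that of `v`, then there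
is a perfect pairing between `J \ I` and `I \ J` that is exchangeable with respect to `J` and
respects the ranks. -/
lemma exists_perfect_pairing {M : FinMatroid α} {part : α → ι}
    (hds : ∀ X : Finset α, M.Indep X ↔ ∀ j : ι, M.Indep (X.filter fun a => part a = j))
    (rank : α → ℕ) {J : Finset α} (hJ : M.Indep J) (n : ℕ) : ∀ {I : Finset α}, M.Indep I →
    (∀ j, (I.filter fun a => part a = j).card = (J.filter fun a => part a = j).card) →
    (∀ v ∈ J \ I, ∀ u ∈ I, M.Indep (insert v (I.erase u)) → rank v ≤ rank u) →
    (J \ I).card = n →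
    ∃ N, IsPairing J I N ∧
      (∀ p ∈ N, M.Indep (insert p.2 (J.erase p.1)) ∧ part p.1 = part p.2 ∧
        rank p.1 ≤ rank p.2) ∧
      (∀ v ∈ J \ I, ∃ p ∈ N, p.1 = v) ∧ (∀ u ∈ I \ J, ∃ p ∈ N, p.2 = u) := by
  induction n with
  | zero =>
    intro I _ hcard _ hn
    have hJI := card_eq_zero.1 hn
    refine ⟨∅, by simp [IsPairing], by simp, by simp [hJI], fun u hu => ?_⟩
    have h := card_filter_add_card_filter_sdiff I J fun a => part a = part u
    rw [hcard, hJI, filter_empty, card_empty, Nat.add_left_cancel_iff] at h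
    exact absurd rfl (filter_eq_empty_iff.1 (card_eq_zero.1 h.symm) hu)
  | succ n ih =>
    intro I hI hcard hrank hn
    obtain ⟨v, hv, hmax⟩ := exists_max_image (J \ I) rank (card_pos.1 (by omega))
    obtain ⟨hvJ, hvI⟩ := mem_sdiff.1 hv
    obtain ⟨u, hu, hIu, hJv⟩ := M.symmetric_exchange
      (I := I.filter fun a => part a = part v) (J := J.filter fun a => part a = part v)
      (M.indep_subset (filter_subset _ _) hI) (M.indep_subset (filter_subset _ _) hJ)
      (hcard _) (v := v) (by simp [hvJ, hvI])
    obtain ⟨huI, huv⟩ := mem_filter.1 (mem_sdiff.1 hu).1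
    have huJ : u ∉ J := fun h => (mem_sdiff.1 hu).2 (mem_filter.2 ⟨h, huv⟩)
    have hne : u ≠ v := fun h => huJ (h ▸ hvJ)
    have hI' : M.Indep (insert v (I.erase u)) := by
      refine M.indep_of_indep_filter hds hI (j := part v) (by grind) ?_
      convert hIu using 1
      ext a; grind
    have hJ' : M.Indep (insert u (J.erase v)) := by
      refine M.indep_of_indep_filter hds hJ (j := part v) (by grind) ?_
      convert hJv using 1
      ext a; grind
    have hJI' : J \ insert v (I.erase u) = (J \ I).erase v := by ext a; grind
    have hIJ' : insert v (I.erase u) \ J = (I \ J).erase u := by ext a; grind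
    have hcard' : ∀ j, ((insert v (I.erase u)).filter fun a => part a = j).card =
        (J.filter fun a => part a = j).card := by
      intro j
      rw [← hcard j]
      by_cases hj : part v = j
      · have : (insert v (I.erase u)).filter (fun a => part a = j) =
            insert v ((I.filter fun a => part a = j).erase u) := by ext a; grind
        rw [this, card_insert_of_notMem (by simp [hvI]),
          card_erase_add_one (mem_filter.2 ⟨huI, huv.trans hj⟩)]
      · congr 1
        ext a; grind
    obtain ⟨N, hN, hex, hcovJ, hcovI⟩ := ih hI' hcard' (by
      intro w hw x hx hind
      rw [hJI'] at hw
      obtain ⟨hwv, hw⟩ := mem_erase.1 hw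
      rcases mem_insert.1 hx with hxv | hx
      · exact hxv ▸ hmax w hw
      obtain ⟨hxu, hxI⟩ := mem_erase.1 hx
      have hwI := (mem_sdiff.1 hw).2
      obtain ⟨y, hy, hyi⟩ := M.indep_exchange (M.indep_subset (erase_subset x I) hI) hind (by
        rw [card_insert_of_notMem (by simp [hwv, hwI]), card_erase_add_one (mem_insert_of_mem hx),
          card_insert_of_notMem (by simp [hvI]), card_erase_add_one huI]
        exact card_erase_lt_of_mem hxI)
      have hy' : y = v ∨ y = w := by
        simp only [mem_sdiff, mem_insert, mem_erase] at hy
        tauto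
      rcases hy' with hy' | hy'
      · exact (hmax w hw).trans (hrank v hv x hxI (hy' ▸ hyi))
      · exact hrank w hw x hxI (hy' ▸ hyi)) (by rw [hJI', card_erase_of_mem hv, hn]; rfl)
    rw [hJI'] at hcovJ
    rw [hIJ'] at hcovI
    have hmem : ∀ p ∈ N, p.1 ∈ (J \ I).erase v ∧ p.2 ∈ (I \ J).erase u := fun p hp =>
      hJI' ▸ hIJ' ▸ hN.1 p hp
    refine ⟨insert (v, u) N, ⟨?_, ?_, ?_⟩, ?_, ?_, ?_⟩
    · intro p hp
      rcases mem_insert.1 hp with rfl | hp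
      · simp [hvJ, hvI, huI, huJ]
      · exact ⟨mem_of_mem_erase (hmem p hp).1, mem_of_mem_erase (hmem p hp).2⟩
    · intro p hp q hq h
      rcases mem_insert.1 hp with hp | hp <;> rcases mem_insert.1 hq with hq | hq
      · rw [hp, hq]
      · exact absurd (h.symm.trans (congrArg Prod.fst hp)) (mem_erase.1 (hmem q hq).1).1
      · exact absurd (h.trans (congrArg Prod.fst hq)) (mem_erase.1 (hmem p hp).1).1
      · exact hN.2.1 p hp q hq h
    · intro p hp q hq h
      rcases mem_insert.1 hp with hp | hp <;> rcases mem_insert.1 hq with hq | hq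
      · rw [hp, hq]
      · exact absurd (h.symm.trans (congrArg Prod.snd hp)) (mem_erase.1 (hmem q hq).2).1
      · exact absurd (h.trans (congrArg Prod.snd hq)) (mem_erase.1 (hmem p hp).2).1
      · exact hN.2.2 p hp q hq h
    · intro p hp
      rcases mem_insert.1 hp with rfl | hp
      · exact ⟨hJ', huv.symm, hrank v hv u huI hI'⟩
      · exact hex p hp
    · intro w hw
      by_cases h : w = v
      · exact ⟨(v, u), mem_insert_self _ _, h.symm⟩
      · obtain ⟨p, hp, hpw⟩ := hcovJ w (mem_erase.2 ⟨h, hw⟩)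
        exact ⟨p, mem_insert_of_mem hp, hpw⟩
    · intro w hw
      by_cases h : w = u
      · exact ⟨(v, u), mem_insert_self _ _, h.symm⟩
      · obtain ⟨p, hp, hpw⟩ := hcovI w (mem_erase.2 ⟨h, hw⟩)
        exact ⟨p, mem_insert_of_mem hp, hpw⟩

/-- A part in which `I` is smaller than `J` contains an element of `J` that can be added
to `I`. -/
lemma FinMatroid.exists_insert_of_card_filter_lt {M : FinMatroid α} {part : α → ι}
    (hds : ∀ X : Finset α, M.Indep X ↔ ∀ j : ι, M.Indep (X.filter fun a => part a = j))
    {I J : Finset α} (hI : M.Indep I) (hJ : M.Indep J) {j : ι}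
    (h : (I.filter fun a => part a = j).card < (J.filter fun a => part a = j).card) :
    ∃ z ∈ J \ I, part z = j ∧ M.Indep (insert z I) := by
  obtain ⟨z, hz, hzi⟩ := M.indep_exchange (M.indep_subset (filter_subset _ _) hI)
    (M.indep_subset (filter_subset _ _) hJ) h
  obtain ⟨hzJ, hzj⟩ := mem_filter.1 (mem_sdiff.1 hz).1
  refine ⟨z, by grind, hzj, M.indep_of_indep_filter hds hI (j := j) (by grind) ?_⟩
  convert hzi using 1
  ext a; grind

/-- If every exchange of an element of `I` for an element `v` of `J` leaves an element of rank at
least that of `v`, then some feasible pairing for `(J, I)` respects the ranks. -/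
lemma exists_feasible_of_rank {M : FinMatroid α} {part : α → ι}
    (hds : ∀ X : Finset α, M.Indep X ↔ ∀ j : ι, M.Indep (X.filter fun a => part a = j))
    (rank : α → ℕ) (n : ℕ) : ∀ {I J : Finset α}, M.Indep I → M.Indep J →
    (∀ v ∈ J \ I, ∀ u ∈ I, M.Indep (insert v (I.erase u)) → rank v ≤ rank u) →
    (∀ v ∈ J \ I, M.Indep (insert v I) → rank v = 0) →
    (J \ I).card + (I \ J).card = n →
    ∃ N, Feasible M part J I N ∧ ∀ p ∈ N, rank p.1 ≤ rank p.2 := by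
  induction n using Nat.strong_induction_on with
  | _ n ih =>
    intro I J hI hJ hrank hzero hn
    by_cases hlt : ∃ j, (I.filter fun a => part a = j).card < (J.filter fun a => part a = j).card
    · obtain ⟨j, hj⟩ := hlt
      obtain ⟨z, hz, hzj, hzI⟩ := M.exists_insert_of_card_filter_lt hds hI hJ hj
      obtain ⟨hzJ, hzI'⟩ := mem_sdiff.1 hz
      have hJI : J \ insert z I = (J \ I).erase z := sdiff_insert ..
      have hIJ : insert z I \ J = I \ J := insert_sdiff_of_mem _ hzJ
      obtain ⟨N, ⟨⟨hN, hex, hcovI⟩, hcovJ, hpart, hcnt⟩, hr⟩ := ih _ (by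
          rw [← hn, ← card_erase_add_one hz, add_right_comm]; exact Nat.lt_succ_self _) hzI hJ
        (by
          intro v hv u hu hind
          have hv' : v ∈ J \ I := mem_of_mem_erase (hJI ▸ hv)
          rcases mem_insert.1 hu with rfl | hu
          · rw [erase_insert hzI'] at hind
            rw [hzero v hv' hind]
            exact Nat.zero_le _
          · exact hrank v hv' u hu (M.indep_subset
              (insert_subset_insert _ (erase_subset_erase _ (subset_insert _ _))) hind))
        (by
          intro v hv hind
          exact hzero v (mem_of_mem_erase (hJI ▸ hv))
            (M.indep_subset (insert_subset_insert _ (subset_insert _ _)) hind))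
        (by rw [hJI, hIJ])
      rw [hJI] at hcovJ hcnt
      rw [hIJ] at hcovI hcnt
      refine ⟨N, ⟨⟨⟨fun p hp => ?_, hN.2⟩, hex, hcovI⟩, ?_, hpart, fun k => ?_⟩, hr⟩
      · have h := hN.1 p hp
        rw [hJI, hIJ] at h
        exact ⟨mem_of_mem_erase h.1, h.2⟩
      · intro v hv hdep
        by_cases hvz : v = z
        · exact absurd (hvz ▸ hzI) hdep
        · exact hcovJ v (mem_erase.2 ⟨hvz, hv⟩) fun h =>
            hdep (M.indep_subset (insert_subset_insert _ (subset_insert _ _)) h)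
      · rw [hcnt]
        by_cases hk : k = j
        · have h := card_filter_add_card_filter_sdiff I J fun a => part a = j
          rw [hk, filter_erase, card_erase_of_mem (mem_filter.2 ⟨hz, hzj⟩)]
          omega
        · rw [filter_erase, erase_eq_of_notMem fun h =>
            hk ((mem_filter.1 h).2.symm.trans hzj)]
    · by_cases hgt : ∃ j, (J.filter fun a => part a = j).card < (I.filter fun a => part a = j).card
      · obtain ⟨j, hj⟩ := hgt
        obtain ⟨z, hz, hzj, hzJ⟩ := M.exists_insert_of_card_filter_lt hds hJ hI hj
        obtain ⟨hzI, hzJ'⟩ := mem_sdiff.1 hz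
        have hIJ : I \ insert z J = (I \ J).erase z := sdiff_insert ..
        have hJI : insert z J \ I = J \ I := insert_sdiff_of_mem _ hzI
        obtain ⟨N, ⟨⟨hN, hex, hcovI⟩, hcovJ, hpart, hcnt⟩, hr⟩ := ih _ (by
            rw [← hn, ← card_erase_add_one hz]; exact Nat.lt_succ_self _) hI hzJ
          (by rwa [hJI]) (by rwa [hJI]) (by rw [hJI, hIJ]; rfl)
        rw [hJI] at hcovJ hcnt
        rw [hIJ] at hcovI hcnt
        refine ⟨N, ⟨⟨⟨fun p hp => ?_, hN.2⟩, fun p hp => ?_, ?_⟩, hcovJ, hpart, fun k => ?_⟩, hr⟩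
        · have h := hN.1 p hp
          rw [hJI, hIJ] at h
          exact ⟨h.1, mem_of_mem_erase h.2⟩
        · exact M.indep_subset
            (insert_subset_insert _ (erase_subset_erase _ (subset_insert _ _))) (hex p hp)
        · intro v hv hdep
          by_cases hvz : v = z
          · exact absurd (hvz ▸ hzJ) hdep
          · exact hcovI v (mem_erase.2 ⟨hvz, hv⟩) fun h =>
            hdep (M.indep_subset (insert_subset_insert _ (subset_insert _ _)) h)
        · rw [hcnt]
          by_cases hk : k = j
          · have h := card_filter_add_card_filter_sdiff I J fun a => part a = j
            rw [hk, filter_erase, card_erase_of_mem (mem_filter.2 ⟨hz, hzj⟩)]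
            omega
          · rw [filter_erase, erase_eq_of_notMem fun h =>
            hk ((mem_filter.1 h).2.symm.trans hzj)]
      · push Not at hlt hgt
        have hcard : ∀ j, (I.filter fun a => part a = j).card =
            (J.filter fun a => part a = j).card := fun j => (hgt j).antisymm (hlt j)
        obtain ⟨N, hN, hex, hcovJ, hcovI⟩ := exists_perfect_pairing hds rank hJ _ hI hcard hrank rfl
        refine ⟨N, ⟨⟨hN, fun p hp => (hex p hp).1, fun v hv _ => hcovI v hv⟩,
          fun u hu _ => hcovJ u hu, fun p hp => (hex p hp).2.1, fun j => ?_⟩,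
          fun p hp => (hex p hp).2.2⟩
        have h := card_filter_add_card_filter_sdiff I J fun a => part a = j
        have hc := hcard j
        rw [hN.card_filter_fst hcovJ fun a => part a = j]
        omega

lemma exists_feasible {M : FinMatroid α} {part : α → ι}
    (hds : ∀ X : Finset α, M.Indep X ↔ ∀ j : ι, M.Indep (X.filter fun a => part a = j))
    {I J : Finset α} (hI : M.Indep I) (hJ : M.Indep J) : ∃ N, Feasible M part I J N :=
  (exists_feasible_of_rank hds (fun _ => 0) _ hJ hI (fun _ _ _ _ _ => le_rfl)
    (fun _ _ _ => rfl) rfl).imp fun _ h => h.1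

end Pairings

section Votes

variable {α : Type*}

/-- Certificate bound: a vote is bounded below by potentials `lam` on `I \ J` and `y` on `J \ I`
that underestimate every paired comparison and are small on uncovered elements. -/
lemma le_voteN_of_potentials [DecidableEq α] {gt : α → α → Prop} {I J : Finset α}
    {N : Finset (α × α)}
    (hN : IsPairing I J N) {lam y : α → ℤ} (hlam : ∀ u, lam u ≤ 1)
    (hcov : ∀ v ∈ J \ I, (∃ p ∈ N, p.2 = v) ∨ y v ≤ -2)
    (hle : ∀ p ∈ N, lam p.1 + y p.2 ≤
      (if gt p.1 p.2 then 1 else 0) - (if gt p.2 p.1 then 1 else 0)) :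
    ∑ u ∈ I \ J, lam u + ∑ v ∈ J \ I, y v + (J \ I).card - N.card ≤ voteN gt I J N := by
  have hfst : ∑ u ∈ I \ J, (lam u - 1) ≤ ∑ p ∈ N, (lam p.1 - 1) := by
    rw [← sum_image (f := fun u => lam u - 1) (g := Prod.fst) fun p hp q hq => hN.2.1 p hp q hq,
      ← neg_le_neg_iff, ← sum_neg_distrib, ← sum_neg_distrib]
    refine sum_le_sum_of_subset_of_nonneg (fun u hu => ?_) fun u _ _ => ?_
    · obtain ⟨p, hp, rfl⟩ := mem_image.1 hu
      exact (hN.1 p hp).1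
    · linarith [hlam u]
  have hsnd : ∑ v ∈ J \ I, (y v + 2) ≤ ∑ p ∈ N, (y p.2 + 2) := by
    rw [← sum_image (f := fun v => y v + 2) (g := Prod.snd) fun p hp q hq => hN.2.2 p hp q hq,
      ← neg_le_neg_iff, ← sum_neg_distrib, ← sum_neg_distrib]
    refine sum_le_sum_of_subset_of_nonneg (fun v hv => ?_) fun v hv hv' => ?_
    · obtain ⟨p, hp, rfl⟩ := mem_image.1 hv
      exact (hN.1 p hp).2
    · rcases hcov v hv with ⟨p, hp, rfl⟩ | h
      · exact absurd (mem_image_of_mem _ hp) hv'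
      · linarith
  have hsum := sum_le_sum hle
  have hcard : (I.card : ℤ) + (J \ I).card = J.card + (I \ J).card := by
    have := card_filter_add_card_filter_sdiff I J fun _ => True
    simp only [filter_true] at this
    exact_mod_cast this
  simp only [sum_sub_distrib, sum_add_distrib, sum_const, nsmul_eq_mul, mul_one] at hfst hsnd hsum
  simp only [voteN, card_filter, Nat.cast_sum, Nat.cast_ite, Nat.cast_one, Nat.cast_zero]
  linarith

lemma IsPairing.card_le_left [DecidableEq α] {I J : Finset α} {N : Finset (α × α)}
    (hN : IsPairing I J N) : N.card ≤ (I \ J).card :=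
  card_le_card_of_injOn Prod.fst (fun p hp => (hN.1 p hp).1) fun p hp q hq => hN.2.1 p hp q hq

lemma IsPairing.card_le_right [DecidableEq α] {I J : Finset α} {N : Finset (α × α)}
    (hN : IsPairing I J N) : N.card ≤ (J \ I).card :=
  card_le_card_of_injOn Prod.snd (fun p hp => (hN.1 p hp).2) fun p hp q hq => hN.2.2 p hp q hq

lemma IsPairing.image_swap [DecidableEq α] {I J : Finset α} {N : Finset (α × α)}
    (hN : IsPairing J I N) : IsPairing I J (N.image Prod.swap) := by
  refine ⟨fun p hp => ?_, fun p hp q hq h => ?_, fun p hp q hq h => ?_⟩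
  · obtain ⟨a, ha, rfl⟩ := mem_image.1 hp
    exact (hN.1 a ha).symm
  · obtain ⟨a, ha, rfl⟩ := mem_image.1 hp
    obtain ⟨b, hb, rfl⟩ := mem_image.1 hq
    rw [hN.2.2 a ha b hb h]
  · obtain ⟨a, ha, rfl⟩ := mem_image.1 hp
    obtain ⟨b, hb, rfl⟩ := mem_image.1 hq
    rw [hN.2.1 a ha b hb h]

lemma voteN_image_swap [DecidableEq α] (gt : α → α → Prop) (I J : Finset α)
    (N : Finset (α × α)) : voteN gt I J (N.image Prod.swap) = -voteN gt J I N := by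
  simp only [voteN, filter_image, card_image_of_injective _ Prod.swap_injective, Prod.fst_swap,
    Prod.snd_swap]
  ring

/-- The potential of an element on level `c`. -/
def levelPotential (best c : Bool) : ℤ := if c = best then -1 else 1

lemma levelPotential_add_levelPotential_not (best c : Bool) :
    levelPotential best c + levelPotential (!best) c = 0 := by
  cases best <;> cases c <;> rfl

/-- The potential of an element outside `I`, depending on which of its copies satisfy `D`. -/
def domPotential (best : Bool) (D : Bool → Prop) : ℤ :=
  if D best then 2 else if D (!best) then 0 else -2

lemma domPotential_add_nonneg {best : Bool} {D₁ D₂ : Bool → Prop} (h : ∀ c, D₁ c ∨ D₂ c) :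
    0 ≤ domPotential best D₁ + domPotential (!best) D₂ := by
  have hb := h best
  have hn := h (!best)
  simp only [domPotential, Bool.not_not]
  split_ifs <;> first | omega | tauto

lemma finite_setOf_voteN [Finite α] {gt : α → α → Prop} (P : Finset (α × α) → Prop)
    (I J : Finset α) :
    {z : ℤ | ∃ N, P N ∧ z = voteN gt I J N}.Finite :=
  (Set.finite_range fun N => voteN gt I J N).subset fun _ ⟨N, _, hz⟩ => ⟨N, hz.symm⟩

/-- A strict total order on a finite type is represented by a bounded injective rank. -/
lemma exists_rank_of_isStrictTotalOrder [Fintype α] {gt : α → α → Prop}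
    (h : IsStrictTotalOrder α gt) :
    ∃ rk : α → ℕ, (∀ a b, gt a b ↔ rk b < rk a) ∧ Function.Injective rk ∧
      ∀ a, rk a < Fintype.card α := by
  let rk : α → ℕ := fun a => (univ.filter (gt a)).card
  have hmono : ∀ a b, gt a b → rk b < rk a := fun a b hab => card_lt_card <| by
    refine (ssubset_iff_of_subset fun c hc => ?_).2 ⟨b, by simpa using hab, by simp [irrefl]⟩
    simp only [mem_filter_univ] at hc ⊢
    exact _root_.trans hab hc
  refine ⟨rk, fun a b => ⟨hmono a b, fun hlt => ?_⟩, fun a b hab => ?_, fun a => ?_⟩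
  · rcases trichotomous_of gt a b with h | rfl | h
    · exact h
    · exact absurd hlt (lt_irrefl _)
    · exact absurd (hmono b a h) hlt.asymm
  · rcases trichotomous_of gt a b with h | h | h
    · exact absurd hab (hmono a b h).ne'
    · exact h
    · exact absurd hab (hmono b a h).ne
  · exact card_lt_card ((ssubset_univ_iff).2 fun h => irrefl (r := gt) a <| by
      simpa using h.ge (mem_univ a))

variable [DecidableEq α] {M : FinMatroid α} {gt : α → α → Prop} {n : ℕ} {rk : α → ℕ}

lemma le_voteN_of_key_le (hgt : ∀ a b, gt a b ↔ rk b < rk a) (hinj : Function.Injective rk)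
    (hlt : ∀ a, rk a < n) (best : Bool) {I J : Finset α} {lev : α → Bool} {N : Finset (α × α)}
    (hN : IsPairing I J N) (hcov : ∀ v ∈ J \ I, ¬ M.Indep (insert v I) → ∃ p ∈ N, p.2 = v)
    (hkey : ∀ p ∈ N, ∀ c, Dominated M (levelKey n rk best) I lev p.2 c →
      levelKey n rk best (p.2, c) ≤ levelKey n rk best (p.1, lev p.1)) :
    ∑ u ∈ I \ J, levelPotential best (lev u) +
      ∑ v ∈ J \ I, domPotential best (Dominated M (levelKey n rk best) I lev v) +
      (J \ I).card - N.card ≤ voteN gt I J N := by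
  refine le_voteN_of_potentials hN (fun u => ?_) (fun v hv => ?_) fun p hp => ?_
  · unfold levelPotential
    split_ifs <;> omega
  · by_cases hind : M.Indep (insert v I)
    · right
      simp [domPotential, Dominated, hind]
    · exact Or.inl (hcov v hv hind)
  · have hne : rk p.1 ≠ rk p.2 := fun h => by
      have := hN.1 p hp
      rw [hinj h] at this
      exact (mem_sdiff.1 this.1).2 (mem_sdiff.1 this.2).1
    have hb := hkey p hp best
    have hnb := hkey p hp (!best)
    have h₁ := hlt p.1
    have h₂ := hlt p.2
    simp only [hgt, levelPotential, domPotential]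
    simp only [levelKey, if_true, Bool.not_eq_self, if_false] at hb hnb
    split_ifs at hb hnb ⊢ <;> first | omega | (have := hb ‹_›; omega) | (have := hnb ‹_›; omega)

lemma le_voteN_of_weaklyFeasible (hgt : ∀ a b, gt a b ↔ rk b < rk a)
    (hinj : Function.Injective rk) (hlt : ∀ a, rk a < n) (best : Bool) {I J : Finset α}
    (lev : α → Bool) {N : Finset (α × α)} (hN : WeaklyFeasible M I J N) :
    ∑ u ∈ I \ J, levelPotential best (lev u) +
      ∑ v ∈ J \ I, domPotential best (Dominated M (levelKey n rk best) I lev v) ≤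
      voteN gt I J N := by
  have h := le_voteN_of_key_le (lev := lev) hgt hinj hlt best hN.1 hN.2.2 fun p hp c hc =>
    hc.2 p.1 (mem_sdiff.1 (hN.1.1 p hp).1).1 (hN.2.1 p hp)
  have := hN.1.card_le_right
  omega

lemma exists_feasible_voteN_le {ι : Type*} {part : α → ι}
    (hds : ∀ X : Finset α, M.Indep X ↔ ∀ j : ι, M.Indep (X.filter fun a => part a = j))
    (hgt : ∀ a b, gt a b ↔ rk b < rk a) (hinj : Function.Injective rk)
    (hlt : ∀ a, rk a < n) (best : Bool) {I J : Finset α} (lev : α → Bool)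
    (hI : M.Indep I) (hJ : M.Indep J) :
    ∃ N, Feasible M part J I N ∧ voteN gt J I N ≤
      -(∑ u ∈ I \ J, levelPotential best (lev u) +
        ∑ v ∈ J \ I, domPotential best (Dominated M (levelKey n rk best) I lev v) +
        (J \ I).card - (I \ J).card) := by
  set key := levelKey n rk best with hkey
  let rank : α → ℕ := fun a => if a ∈ I then key (a, lev a) else
    univ.sup fun c => if Dominated M key I lev a c then key (a, c) else 0
  have hrankI : ∀ u ∈ I, rank u = key (u, lev u) := fun u hu => if_pos hu
  have hrankJ : ∀ v ∉ I, rank v =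
      univ.sup fun c => if Dominated M key I lev v c then key (v, c) else 0 := fun v hv => if_neg hv
  obtain ⟨N, hN, hr⟩ := exists_feasible_of_rank hds rank _ hI hJ (by
    intro v hv u hu hind
    rw [hrankI u hu, hrankJ v (mem_sdiff.1 hv).2]
    refine Finset.sup_le fun c _ => ?_
    split_ifs with hc
    · exact hc.2 u hu hind
    · exact Nat.zero_le _) (by
    intro v hv hind
    rw [hrankJ v (mem_sdiff.1 hv).2]
    simp [Dominated, hind]) rfl
  refine ⟨N, hN, ?_⟩
  have hswap := hN.1.1.image_swap
  have h := le_voteN_of_key_le (M := M) (lev := lev) hgt hinj hlt best hswap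
    (fun v hv hdep => by
      obtain ⟨p, hp, rfl⟩ := hN.2.1 v hv hdep
      exact ⟨p.swap, mem_image_of_mem _ hp, rfl⟩)
    (fun q hq c hc => by
      obtain ⟨p, hp, rfl⟩ := mem_image.1 hq
      have hmem := hN.1.1.1 p hp
      have hp' := hr p hp
      rw [hrankI p.2 (mem_sdiff.1 hmem.2).1, hrankJ p.1 (mem_sdiff.1 hmem.1).2] at hp'
      have hle := (Finset.le_sup
        (f := fun c => if Dominated M key I lev p.1 c then key (p.1, c) else 0)
        (mem_univ c)).trans hp'
      exact (if_pos hc).symm.trans_le hle)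
  have hcard := hswap.card_le_left
  rw [voteN_image_swap, ← hkey] at h
  omega

end Votes

/-- for ordered matroids `M₁`, `M₂` on the same finite ground set, each presented
as a direct sum along partitions `part₁`, `part₂`, there exists a maximum-size popular common
independent set: a popular `I ∈ 𝓘₁ ∩ 𝓘₂` with `|J| ≤ |I|` for every popular `J ∈ 𝓘₁ ∩ 𝓘₂`.
(`gtᵢ a b` means `a ≻ᵢ b`.) -/
theorem stmt_10 {α ι₁ ι₂ : Type*} [DecidableEq α] [Fintype α]
    (M₁ M₂ : FinMatroid α) (gt₁ gt₂ : α → α → Prop)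
    (h₁ : IsStrictTotalOrder α gt₁) (h₂ : IsStrictTotalOrder α gt₂)
    (part₁ : α → ι₁) (part₂ : α → ι₂)
    (hdsum₁ : ∀ X : Finset α, M₁.Indep X ↔ ∀ j : ι₁, M₁.Indep (X.filter fun a => part₁ a = j))
    (hdsum₂ : ∀ X : Finset α, M₂.Indep X ↔ ∀ j : ι₂, M₂.Indep (X.filter fun a => part₂ a = j)) :
    ∃ I : Finset α, M₁.Indep I ∧ M₂.Indep I ∧
      (∀ J, M₁.Indep J → M₂.Indep J →
        0 ≤ voteF M₁ gt₁ part₁ I J + voteF M₂ gt₂ part₂ I J) ∧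
      (∀ J, M₁.Indep J → M₂.Indep J →
        (∀ K, M₁.Indep K → M₂.Indep K →
          0 ≤ voteF M₁ gt₁ part₁ J K + voteF M₂ gt₂ part₂ J K) →
        J.card ≤ I.card) := by
  obtain ⟨rk₁, hgt₁, hinj₁, hlt₁⟩ := exists_rank_of_isStrictTotalOrder h₁
  obtain ⟨rk₂, hgt₂, hinj₂, hlt₂⟩ := exists_rank_of_isStrictTotalOrder h₂
  obtain ⟨I, lev, hI₁, hI₂, hdom⟩ := exists_dominating_common_indep M₁ M₂
    (levelKey_injective hinj₁ hlt₁ false) (levelKey_injective hinj₂ hlt₂ true)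
  have hlam : ∀ J : Finset α, ∑ u ∈ I \ J, levelPotential false (lev u) +
      ∑ u ∈ I \ J, levelPotential true (lev u) = 0 := fun J => by
    rw [← sum_add_distrib]
    exact sum_eq_zero fun u _ => levelPotential_add_levelPotential_not false (lev u)
  have hdomp : ∀ J : Finset α, 0 ≤
      ∑ v ∈ J \ I, domPotential false
        (Dominated M₁ (levelKey (Fintype.card α) rk₁ false) I lev v) +
      ∑ v ∈ J \ I, domPotential true
        (Dominated M₂ (levelKey (Fintype.card α) rk₂ true) I lev v) := fun J => by
    rw [← sum_add_distrib]
    exact sum_nonneg fun v hv => domPotential_add_nonneg (best := false)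
      (hdom v (mem_sdiff.1 hv).2)
  refine ⟨I, hI₁, hI₂, fun J hJ₁ hJ₂ => ?_, fun J hJ₁ hJ₂ hpop => ?_⟩
  · have hne₁ : {z : ℤ | ∃ N, Feasible M₁ part₁ I J N ∧
        z = voteN gt₁ I J N}.Nonempty :=
      (exists_feasible hdsum₁ hI₁ hJ₁).elim fun N hN => ⟨_, N, hN, rfl⟩
    have hne₂ : {z : ℤ | ∃ N, Feasible M₂ part₂ I J N ∧
        z = voteN gt₂ I J N}.Nonempty :=
      (exists_feasible hdsum₂ hI₂ hJ₂).elim fun N hN => ⟨_, N, hN, rfl⟩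
    obtain ⟨N₁, hN₁, hv₁⟩ := Int.csInf_mem hne₁
      (finite_setOf_voteN (gt := gt₁) (Feasible M₁ part₁ I J) I J).bddBelow
    obtain ⟨N₂, hN₂, hv₂⟩ := Int.csInf_mem hne₂
      (finite_setOf_voteN (gt := gt₂) (Feasible M₂ part₂ I J) I J).bddBelow
    rw [voteF, voteF, hv₁, hv₂]
    have b₁ := le_voteN_of_weaklyFeasible hgt₁ hinj₁ hlt₁ false lev hN₁.1
    have b₂ := le_voteN_of_weaklyFeasible hgt₂ hinj₂ hlt₂ true lev hN₂.1
    linarith [hlam J, hdomp J]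
  · by_contra! hcard
    obtain ⟨N₁, hN₁, hv₁⟩ :=
      exists_feasible_voteN_le hdsum₁ hgt₁ hinj₁ hlt₁ false lev hI₁ hJ₁
    obtain ⟨N₂, hN₂, hv₂⟩ :=
      exists_feasible_voteN_le hdsum₂ hgt₂ hinj₂ hlt₂ true lev hI₂ hJ₂
    have b₁ : voteF M₁ gt₁ part₁ J I ≤ voteN gt₁ J I N₁ :=
      csInf_le (finite_setOf_voteN _ J I).bddBelow ⟨N₁, hN₁, rfl⟩
    have b₂ : voteF M₂ gt₂ part₂ J I ≤ voteN gt₂ J I N₂ :=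
      csInf_le (finite_setOf_voteN _ J I).bddBelow ⟨N₂, hN₂, rfl⟩
    have hsd : ((I \ J).card : ℤ) < (J \ I).card := by
      have := card_filter_add_card_filter_sdiff I J fun _ => True
      simp only [filter_true] at this
      omega
    linarith [hlam J, hdomp J, hpop I hI₁ hI₂]

end
end
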